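/- Let V : ℤ → ℝ be periodic with period p ≥ 1 and let H be the Schrödinger operator on ℓ²(ℤ) with potential V. Then σ(H) = {E ∈ ℝ : |Δ(E)| ≤ 2}, where Δ is the discriminant of V. -/

import Mathlib

/-- The transfer matrix over `n` sites: `T_n^{(E,V)} = S_{n-1} ⋯ S_0`, where
`S_i^{(E,V)} = !![E - V i, -1; 1, 0]`. -/
def transferMatrix (E : ℝ) (V : ℤ → ℝ) : ℕ → Matrix (Fin 2) (Fin 2) ℝ
  | 0 => 1
  | n + 1 => !![E - V n, -1; 1, 0] * transferMatrix E V n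

/-- The discriminant `Δ(E) = tr T_p^{(E,V)}` of a `p`-periodic potential. -/
def discriminant (V : ℤ → ℝ) (p : ℕ) (E : ℝ) : ℝ :=
  (transferMatrix E V p).trace

open Polynomial in
/-- The polynomial version of `transferMatrix`, with the energy as the indeterminate. -/
noncomputable def polyTransferMatrix (V : ℤ → ℝ) : ℕ → Matrix (Fin 2) (Fin 2) ℝ[X]
  | 0 => 1
  | n + 1 => !![X - C (V n), -1; 1, 0] * polyTransferMatrix V n

/-- The discriminant as a polynomial in the energy. -/
noncomputable def polyDiscriminant (V : ℤ → ℝ) (p : ℕ) : Polynomial ℝ :=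
  (polyTransferMatrix V p).trace

lemma polyTransferMatrix_eval (V : ℤ → ℝ) (E : ℝ) (n : ℕ) (i j : Fin 2) :
    (polyTransferMatrix V n i j).eval E = transferMatrix E V n i j := by
  induction n generalizing i j with
  | zero => fin_cases i <;> fin_cases j <;> simp [polyTransferMatrix, transferMatrix]
  | succ n ih =>
    fin_cases i <;> fin_cases j <;>
      simp [polyTransferMatrix, transferMatrix, Matrix.mul_apply, Fin.sum_univ_two, ih]

lemma polyDiscriminant_eval (V : ℤ → ℝ) (p : ℕ) (E : ℝ) :
    (polyDiscriminant V p).eval E = discriminant V p E := by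
  simp [polyDiscriminant, discriminant, Matrix.trace_fin_two, polyTransferMatrix_eval]

lemma polyTransferMatrix_det (V : ℤ → ℝ) (n : ℕ) : (polyTransferMatrix V n).det = 1 := by
  induction n with
  | zero => simp [polyTransferMatrix]
  | succ n ih =>
    rw [polyTransferMatrix, Matrix.det_mul, ih, Matrix.det_fin_two_of]
    ring

section Recurrence

open Polynomial

variable {M : Type*} [AddCommGroup M] [Module ℝ[X] M]

/-- Solutions `d` of `d (n + 1) + d (n - 1) + V n • d n = X • d n` in an `ℝ[X]`-module. -/
def SolvesRecurrence (V : ℤ → ℝ) (d : ℤ → M) : Prop :=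
  ∀ n, d (n + 1) = (X - C (V n) : ℝ[X]) • d n - d (n - 1)

lemma SolvesRecurrence.eq_transfer {V : ℤ → ℝ} {d : ℤ → M} (h : SolvesRecurrence V d) (n : ℕ) :
    d n = polyTransferMatrix V n 0 0 • d 0 + polyTransferMatrix V n 0 1 • d (-1) ∧
      d (n - 1) = polyTransferMatrix V n 1 0 • d 0 + polyTransferMatrix V n 1 1 • d (-1) := by
  induction n with
  | zero => simp [polyTransferMatrix]
  | succ n ih =>
    constructor
    · rw [Nat.cast_succ, h n]
      conv_lhs => rw [ih.1, ih.2]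
      simp only [polyTransferMatrix, Matrix.mul_apply, Fin.sum_univ_two]
      simp
      module
    · rw [Nat.cast_succ, add_sub_cancel_right, ih.1]
      simp [polyTransferMatrix, Matrix.mul_apply, Fin.sum_univ_two]

lemma SolvesRecurrence.translate {V : ℤ → ℝ} {d : ℤ → M} (h : SolvesRecurrence V d) {k : ℤ}
    (hk : ∀ n, V (n + k) = V n) : SolvesRecurrence V fun n => d (n + k) := by
  intro n
  have := h (n + k)
  rwa [hk, add_right_comm, add_sub_right_comm] at this

lemma SolvesRecurrence.eq_zero {V : ℤ → ℝ} {d : ℤ → M} (h : SolvesRecurrence V d)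
    (h0 : d 0 = 0) (h1 : d (-1) = 0) (n : ℤ) : d n = 0 := by
  suffices d n = 0 ∧ d (n - 1) = 0 from this.1
  induction n with
  | zero => simp [h0, h1]
  | succ n ih => exact ⟨by rw [h, ih.1, ih.2]; simp, by simpa using ih.1⟩
  | pred n ih =>
    refine ⟨ih.2, ?_⟩
    have := h (-n - 1)
    rw [sub_add_cancel, ih.1, ih.2] at this
    simpa using this.symm

/-- Cayley–Hamilton for the monodromy: translating forward and backward by a period and adding
multiplies a solution by the discriminant. -/
lemma SolvesRecurrence.add_eq_discriminant_smul {V : ℤ → ℝ} {d : ℤ → M}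
    (h : SolvesRecurrence V d) {p : ℕ} (hV : ∀ n : ℤ, V (n + p) = V n) (n : ℤ) :
    d (n + p) + d (n - p) = polyDiscriminant V p • d n := by
  have hV' : ∀ n : ℤ, V (n + -p) = V n := fun n => by rw [← hV, neg_add_cancel_right]
  have hp := h.translate hV
  have hm := h.translate hV'
  have e := h.eq_transfer p
  have e' := hm.eq_transfer p
  have hdet := polyTransferMatrix_det V p
  rw [Matrix.det_fin_two] at hdet
  have hD : polyDiscriminant V p = polyTransferMatrix V p 0 0 + polyTransferMatrix V p 1 1 :=
    Matrix.trace_fin_two _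
  have hs : SolvesRecurrence V
      fun n => d (n + p) + d (n + -p) - polyDiscriminant V p • d n := by
    intro n
    have h1 := hp n
    have h2 := hm n
    simp only at h1 h2 ⊢
    rw [h1, h2, h n]
    module
  have key := hs.eq_zero ?_ ?_ n
  · rw [sub_eq_zero] at key
    simpa [sub_eq_add_neg] using key
  all_goals
    generalize polyTransferMatrix V p 0 0 = a at *
    generalize polyTransferMatrix V p 0 1 = b at *
    generalize polyTransferMatrix V p 1 0 = c at *
    generalize polyTransferMatrix V p 1 1 = t at *
    simp only [zero_add, add_neg_cancel] at e' ⊢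
    have e1 : d (p - 1 + -p) = d (-1) := by rw [show (p : ℤ) - 1 + -p = -1 by ring]
    have e2 : d (-1 + p) = d (p - 1) := by rw [show (-1 : ℤ) + p = p - 1 by ring]
    rw [e1] at e'
  · rw [hD, e.1, e'.2, e'.1]
    linear_combination (norm := module) hdet • (-d (-p))
  · rw [hD, e2, e.2, e'.2, e'.1]
    linear_combination (norm := module) hdet • (-d (-1 + -p))

end Recurrence

lemma Function.Periodic.bddAbove_int {f : ℤ → ℝ} {p : ℕ} (hp : 1 ≤ p)
    (hf : Function.Periodic f p) : ∃ C, ∀ n, f n ≤ C := by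
  obtain ⟨C, hC⟩ := ((Set.finite_Icc (0 : ℤ) p).image f).bddAbove
  refine ⟨C, fun n => ?_⟩
  have h : f (n % p) = f n := by
    conv_rhs => rw [← Int.emod_add_mul_ediv n p, mul_comm]
    exact (hf.int_mul _ _).symm
  rw [← h]
  exact hC ⟨n % p, ⟨Int.emod_nonneg _ (by omega),
    (Int.emod_lt_of_pos _ (by omega)).le⟩, rfl⟩

/-- The two-term recurrence `x (n + 2) = v n * x (n + 1) - x n`. -/
def solveRecurrence (v : ℕ → ℝ) (x₀ x₁ : ℝ) : ℕ → ℝ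
  | 0 => x₀
  | 1 => x₁
  | n + 2 => v n * solveRecurrence v x₀ x₁ (n + 1) - solveRecurrence v x₀ x₁ n

lemma exists_ne_zero_solution (V : ℤ → ℝ) (E : ℝ) :
    ∃ u : ℤ → ℝ, u ≠ 0 ∧ ∀ n, u (n + 1) + u (n - 1) + V n * u n = E * u n := by
  refine ⟨fun n => match n with
    | Int.ofNat n => solveRecurrence (fun n => E - V (n + 1)) 1 (E - V 0) n
    | Int.negSucc n => solveRecurrence (fun n => E - V (-(n + 2))) 0 (-1) n,
    fun h => one_ne_zero (congrFun h 0), fun n => ?_⟩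
  match n with
  | Int.ofNat 0 =>
    change (E - V 0) + 0 + V 0 * 1 = E * 1
    ring
  | Int.ofNat (n + 1) =>
    have h : Int.ofNat (n + 1) - 1 = Int.ofNat n := by simp
    rw [h]
    change (E - V (n + 1)) * solveRecurrence _ _ _ (n + 1) - solveRecurrence _ _ _ n
      + solveRecurrence _ _ _ n + V (n + 1) * solveRecurrence _ _ _ (n + 1)
      = E * solveRecurrence _ _ _ (n + 1)
    ring
  | Int.negSucc 0 =>
    change (1 : ℝ) + -1 + V (-1) * 0 = E * 0
    ring
  | Int.negSucc (n + 1) =>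
    have h : Int.negSucc (n + 1) = -((n : ℤ) + 2) := by omega
    have h1 : Int.negSucc (n + 1) + 1 = Int.negSucc n := by omega
    have h2 : Int.negSucc (n + 1) - 1 = Int.negSucc (n + 2) := by omega
    rw [h1, h2]
    change solveRecurrence _ _ _ n + ((E - V (-(n + 2))) * solveRecurrence _ _ _ (n + 1)
      - solveRecurrence _ _ _ n) + V (Int.negSucc (n + 1)) * solveRecurrence _ _ _ (n + 1)
      = E * solveRecurrence _ _ _ (n + 1)
    rw [h]
    ring

open Polynomial in
lemma solution_add_eq_discriminant_mul {V : ℤ → ℝ} {E : ℝ} {u : ℤ → ℝ}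
    (hu : ∀ n, u (n + 1) + u (n - 1) + V n * u n = E * u n)
    {p : ℕ} (hV : ∀ n : ℤ, V (n + p) = V n) (n : ℤ) :
    u (n + p) + u (n - p) = discriminant V p E * u n := by
  let _ : Module ℝ[X] ℝ := Module.compHom ℝ (evalRingHom E)
  have hsmul : ∀ (q : ℝ[X]) (x : ℝ), q • x = q.eval E * x := fun _ _ => rfl
  have h : SolvesRecurrence V u := fun n => by
    rw [hsmul]
    simp only [eval_sub, eval_X, eval_C]
    linear_combination hu n
  rw [h.add_eq_discriminant_smul hV, hsmul, polyDiscriminant_eval]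

/-- For `|Δ(E)| ≤ 2` the eigenvalue equation has a nonzero bounded solution. -/
lemma exists_bounded_solution {V : ℤ → ℝ} {p : ℕ} (hp : 1 ≤ p) (hV : ∀ n : ℤ, V (n + p) = V n)
    {E : ℝ} (hE : |discriminant V p E| ≤ 2) :
    ∃ u : ℤ → ℝ, u ≠ 0 ∧ (∀ n, u (n + 1) + u (n - 1) + V n * u n = E * u n) ∧
      ∃ C, ∀ n, |u n| ≤ C := by
  obtain ⟨u, hu0, hu⟩ := exists_ne_zero_solution V E
  have ht := solution_add_eq_discriminant_mul hu hV
  generalize discriminant V p E = t at *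
  have ht' : ∀ n, u (n + p + p) = t * u (n + p) - u n := fun n => by
    have := ht (n + p)
    rw [add_sub_cancel_right] at this
    linarith
  rcases hE.lt_or_eq with hlt | heq
  · refine ⟨u, hu0, hu, ?_⟩
    have hQ : Function.Periodic (fun n => u (n + p) ^ 2 - t * u (n + p) * u n + u n ^ 2)
        (p : ℤ) := fun n => by
      simp only [ht']
      ring
    obtain ⟨C, hC⟩ := hQ.bddAbove_int hp
    have hpos : 0 < 1 - t ^ 2 / 4 := by
      rw [abs_lt] at hlt
      nlinarith
    refine ⟨√(C / (1 - t ^ 2 / 4)), fun n => Real.abs_le_sqrt ?_⟩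
    rw [le_div_iff₀ hpos]
    nlinarith [hC n, sq_nonneg (u (n + p) - t / 2 * u n)]
  · obtain ⟨s, hs, rfl⟩ : ∃ s : ℝ, |s| = 1 ∧ t = 2 * s :=
      ⟨t / 2, by rw [abs_div, heq]; norm_num, by ring⟩
    have hs2 : s ^ 2 = 1 := by rw [← sq_abs, hs, one_pow]
    have bdd : ∀ w : ℤ → ℝ, (∀ n, w (n + p) = s * w n) → ∃ C, ∀ n, |w n| ≤ C := fun w hw =>
      Function.Periodic.bddAbove_int (f := fun n => |w n|) hp fun n => by
        simp only [hw, abs_mul, hs, one_mul]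
    by_cases hw : (fun n => u (n + p) - s * u n) = 0
    · exact ⟨u, hu0, hu, bdd u fun n => sub_eq_zero.1 (congrFun hw n)⟩
    · refine ⟨_, hw, fun n => ?_, bdd _ fun n => ?_⟩
      · have h1 := hu (n + p)
        rw [hV, add_right_comm n, add_sub_right_comm] at h1
        linear_combination h1 - s * hu n
      · simp only [ht']
        linear_combination u n * hs2

/-- Real square-summable sequences on `ℤ`. -/
local notation "ℓ²" => lp (fun _ : ℤ => ℝ) 2

lemma lp_norm_sq_hasSum (ψ : ℓ²) : HasSum (fun n => ψ n ^ 2) (‖ψ‖ ^ 2) := by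
  simpa using lp.hasSum_norm (p := 2) (by norm_num) ψ

lemma exists_translate (ψ : ℓ²) (k : ℤ) :
    ∃ φ : ℓ², (∀ n, φ n = ψ (n + k)) ∧ ‖φ‖ = ‖ψ‖ := by
  have h : HasSum (fun n => ψ (n + k) ^ 2) (‖ψ‖ ^ 2) :=
    (Equiv.addRight k).hasSum_iff.2 (lp_norm_sq_hasSum ψ)
  have hm : Memℓp (fun n => ψ (n + k)) 2 := memℓp_gen (by simpa using h.summable)
  refine ⟨⟨_, hm⟩, fun n => rfl, ?_⟩
  exact (sq_eq_sq₀ (norm_nonneg _) (norm_nonneg _)).1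
    ((lp_norm_sq_hasSum ⟨_, hm⟩).unique h)

/-- Evaluation at a site, as a linear functional. -/
noncomputable def evalSite (n : ℤ) : Module.Dual ℝ ℓ² where
  toFun ψ := ψ n
  map_add' _ _ := rfl
  map_smul' _ _ := rfl

lemma aeval_dualMap_apply {E : Type*} [NormedAddCommGroup E] [NormedSpace ℝ E] (H : E →L[ℝ] E)
    (q : Polynomial ℝ) (f : Module.Dual ℝ E) (x : E) :
    Polynomial.aeval (H : E →ₗ[ℝ] E).dualMap q f x = f (Polynomial.aeval H q x) := by
  induction q using Polynomial.induction_on generalizing f x with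
  | C a => simp [Algebra.algebraMap_eq_smul_one]
  | add a b ha hb => simp [ha, hb]
  | monomial n a ih =>
    rw [pow_succ, ← mul_assoc, map_mul, mul_comm _ Polynomial.X, map_mul (Polynomial.aeval H),
      Polynomial.aeval_X, Polynomial.aeval_X, Module.End.mul_apply, ih]
    rfl

section Schrodinger

variable {V : ℤ → ℝ} {H : ℓ² →L[ℝ] ℓ²}

lemma aeval_polyDiscriminant_apply
    (hH : ∀ ψ : ℓ², ∀ n : ℤ, H ψ n = ψ (n + 1) + ψ (n - 1) + V n * ψ n)
    {p : ℕ} (hV : ∀ n : ℤ, V (n + p) = V n) (ψ : ℓ²) (n : ℤ) :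
    Polynomial.aeval H (polyDiscriminant V p) ψ n = ψ (n + p) + ψ (n - p) := by
  let φ := (H : ℓ² →ₗ[ℝ] ℓ²).dualMap
  have h : SolvesRecurrence V fun n => Module.AEval'.of φ (evalSite n) := by
    intro n
    have e : evalSite (n + 1) = φ (evalSite n) - V n • evalSite n - evalSite (n - 1) := by
      ext ψ
      have := hH ψ n
      change ψ (n + 1) = H ψ n - V n * ψ n - ψ (n - 1)
      linarith
    simp only [e, sub_smul, Module.AEval'.X_smul_of, Polynomial.C_eq_algebraMap,
      algebraMap_smul, map_sub, map_smul]
  have key := h.add_eq_discriminant_smul hV n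
  rw [← map_add, Module.AEval'.of, ← Module.AEval.of_aeval_smul] at key
  have key' := DFunLike.congr_fun ((Module.AEval.of ℝ _ φ).injective key) ψ
  simp only [Module.End.smul_def, φ, aeval_dualMap_apply] at key'
  exact key'.symm

lemma norm_aeval_polyDiscriminant_le
    (hH : ∀ ψ : ℓ², ∀ n : ℤ, H ψ n = ψ (n + 1) + ψ (n - 1) + V n * ψ n)
    {p : ℕ} (hV : ∀ n : ℤ, V (n + p) = V n) :
    ‖Polynomial.aeval H (polyDiscriminant V p)‖ ≤ 2 := by
  refine ContinuousLinearMap.opNorm_le_bound _ (by norm_num) fun ψ => ?_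
  obtain ⟨φ₁, h₁, hn₁⟩ := exists_translate ψ p
  obtain ⟨φ₂, h₂, hn₂⟩ := exists_translate ψ (-p)
  have : Polynomial.aeval H (polyDiscriminant V p) ψ = φ₁ + φ₂ := by
    ext n
    rw [aeval_polyDiscriminant_apply hH hV, lp.coeFn_add, Pi.add_apply, h₁, h₂, sub_eq_add_neg]
  rw [this, two_mul]
  exact (norm_add_le _ _).trans_eq (by rw [hn₁, hn₂])

lemma truncation_defect {E v : ℝ} {u : ℤ → ℝ} {n : ℤ}
    (hu : u (n + 1) + u (n - 1) + v * u n = E * u n) (N : ℕ) :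
    (E * if -(N : ℤ) ≤ n ∧ n ≤ N then u n else 0) -
      (((if -(N : ℤ) ≤ n + 1 ∧ n + 1 ≤ N then u (n + 1) else 0) +
          if -(N : ℤ) ≤ n - 1 ∧ n - 1 ≤ N then u (n - 1) else 0) +
        v * if -(N : ℤ) ≤ n ∧ n ≤ N then u n else 0) =
    ((if n = N then u (N + 1) else 0) - if n = N + 1 then u N else 0) +
      ((if n = -N then u (-N - 1) else 0) - if n = -N - 1 then u (-N) else 0) := by
  grind

/-- A bounded generalized eigenfunction forces its energy into the spectrum. -/
lemma mem_spectrum_of_bounded_solution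
    (hH : ∀ ψ : ℓ², ∀ n : ℤ, H ψ n = ψ (n + 1) + ψ (n - 1) + V n * ψ n)
    {E : ℝ} {u : ℤ → ℝ} (hu0 : u ≠ 0)
    (hu : ∀ n, u (n + 1) + u (n - 1) + V n * u n = E * u n) {C : ℝ} (hC : ∀ n, |u n| ≤ C) :
    E ∈ spectrum ℝ H := by
  intro hE
  obtain ⟨R, hR⟩ := hE.exists_left_inv
  have hinv : ∀ ψ, R (E • ψ - H ψ) = ψ := fun ψ => by
    simpa [Algebra.algebraMap_eq_smul_one] using DFunLike.congr_fun hR ψ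
  have hfin : ∀ N : ℕ, ∑ n ∈ Finset.Icc (-N : ℤ) N, u n ^ 2 ≤ (‖R‖ * (4 * C)) ^ 2 := by
    intro N
    have hm : Memℓp (fun n => if n ∈ Finset.Icc (-N : ℤ) N then u n else 0) 2 :=
      (memℓp_zero ((Finset.Icc (-N : ℤ) N).finite_toSet.subset fun n hn => by
        by_contra h
        simp_all)).of_exponent_ge zero_le
    let ψ : ℓ² := ⟨_, hm⟩
    have hψ : ∀ n, ψ n = if n ∈ Finset.Icc (-N : ℤ) N then u n else 0 := fun _ => rfl
    have hdefect : E • ψ - H ψ = lp.single 2 (N : ℤ) (u (N + 1)) - lp.single 2 (N + 1 : ℤ) (u N)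
        + (lp.single 2 (-N : ℤ) (u (-N - 1)) - lp.single 2 (-N - 1 : ℤ) (u (-N))) := by
      ext n
      simp only [lp.coeFn_sub, lp.coeFn_add, lp.coeFn_smul, Pi.sub_apply, Pi.add_apply,
        Pi.smul_apply, hH, hψ, lp.single_apply, Pi.single_apply, Finset.mem_Icc, smul_eq_mul]
      exact truncation_defect (hu n) N
    have hnorm : ‖E • ψ - H ψ‖ ≤ 4 * C := by
      rw [hdefect]
      refine (norm_add_le_of_le (norm_sub_le _ _) (norm_sub_le _ _)).trans ?_
      simp only [lp.norm_single (show (0 : ENNReal) < 2 by norm_num), Real.norm_eq_abs]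
      linarith [hC (N + 1), hC N, hC (-N - 1), hC (-N)]
    have hle : ‖ψ‖ ≤ ‖R‖ * (4 * C) := by
      conv_lhs => rw [← hinv ψ]
      exact (R.le_opNorm _).trans (by gcongr)
    calc ∑ n ∈ Finset.Icc (-N : ℤ) N, u n ^ 2 = ∑ n ∈ Finset.Icc (-N : ℤ) N, ψ n ^ 2 :=
          Finset.sum_congr rfl fun n hn => by rw [hψ, if_pos hn]
      _ ≤ ‖ψ‖ ^ 2 := sum_le_hasSum _ (fun _ _ => sq_nonneg _) (lp_norm_sq_hasSum ψ)
      _ ≤ _ := by gcongr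
  have hmem : Memℓp u 2 := by
    refine memℓp_gen' (C := (‖R‖ * (4 * C)) ^ 2) fun s => ?_
    have hs : s ⊆ Finset.Icc (-(s.sup Int.natAbs : ℕ) : ℤ) (s.sup Int.natAbs : ℕ) := fun n hn => by
      have := Finset.le_sup (f := Int.natAbs) hn
      rw [Finset.mem_Icc]
      omega
    refine le_trans ?_ (hfin (s.sup Int.natAbs))
    simpa using Finset.sum_le_sum_of_subset_of_nonneg hs fun n _ _ => sq_nonneg (u n)
  let ψ : ℓ² := ⟨u, hmem⟩
  have hker : E • ψ - H ψ = 0 := by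
    ext n
    simp only [lp.coeFn_sub, lp.coeFn_smul, Pi.sub_apply, Pi.smul_apply, hH, smul_eq_mul]
    exact sub_eq_zero.2 (hu n).symm
  have h0 := hinv ψ
  rw [hker, map_zero] at h0
  exact hu0 (congrArg (fun φ : ℓ² => (φ : ℤ → ℝ)) h0).symm

end Schrodinger

/-- For a `p`-periodic potential `V : ℤ → ℝ` (`p ≥ 1`), the
spectrum of the Schrödinger operator `H` on `ℓ²(ℤ)` with potential `V` equals
`{E : |Δ(E)| ≤ 2}`, where `Δ` is the discriminant of `V`. -/
theorem statement11
    (p : ℕ) (hp : 1 ≤ p) (V : ℤ → ℝ) (hV : ∀ n : ℤ, V (n + p) = V n)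
    (H : lp (fun _ : ℤ => ℝ) 2 →L[ℝ] lp (fun _ : ℤ => ℝ) 2)
    (hH : ∀ ψ : lp (fun _ : ℤ => ℝ) 2, ∀ n : ℤ,
        H ψ n = ψ (n + 1) + ψ (n - 1) + V n * ψ n) :
    spectrum ℝ H = {E : ℝ | |discriminant V p E| ≤ 2} := by
  ext E
  constructor
  · intro hE
    have hD := spectrum.subset_polynomial_aeval H (polyDiscriminant V p) ⟨E, hE, rfl⟩
    have h := spectrum.norm_le_norm_mul_of_mem hD
    simp only [polyDiscriminant_eval] at h
    calc |discriminant V p E| ≤ _ := h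
      _ ≤ 2 * 1 := by
        gcongr
        · exact norm_aeval_polyDiscriminant_le hH hV
        · exact ContinuousLinearMap.norm_id_le
      _ = 2 := mul_one 2
  · intro hE
    obtain ⟨u, hu0, hu, C, hC⟩ := exists_bounded_solution hp hV hE
    exact mem_spectrum_of_bounded_solution hH hu0 hu hC
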